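/- arXiv:1707.07417 — 2 statements merged into one kernel-verified Lean document; each statement's English description precedes it below -/
import Mathlib

section
/- Let X ⊂ P^{a_1} × P^{a_2} be a finite set of points having the (⋆)-property with U(X) = {(i_1,j_1), (i_2,j_2), ..., (i_t,j_t)}. Then, in the bigraded coordinate ring R, I_X = I_{V_1} + I_{V_2}·I_{Z_1} + I_{V_3}·I_{Z_2} + ... + I_{V_t}·I_{Z_{t-1}} + I_{Z_t}. -/
noncomputable section

/-- Points of projective `m`-space over the field `k`. -/
abbrev Pt (k : Type) [Field k] (m : ℕ) := Projectivization k (Fin (m + 1) → k)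

set_option synthInstance.maxHeartbeats 1000000 in
/-- An ideal `I` of a polynomial ring defines an *arithmetically Cohen–Macaulay* (ACM)
quotient if there is a regular sequence on `R/I`, consisting of elements of the irrelevant
maximal ideal (generated by the images of the variables), whose length equals the Krull
dimension of `R/I`.  For a graded quotient of a polynomial ring this says exactly that the
depth of the irrelevant maximal ideal on `R/I` equals the Krull dimension, i.e. that `R/I`
is a Cohen–Macaulay ring. -/
def IsACM {k : Type} [Field k] {σ : Type} (I : Ideal (MvPolynomial σ k)) : Prop :=
  ∃ rs : List (MvPolynomial σ k ⧸ I),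
    (∀ r ∈ rs,
      r ∈ Ideal.map (Ideal.Quotient.mk I)
            (Ideal.span (Set.range (MvPolynomial.X : σ → MvPolynomial σ k)))) ∧
    RingTheory.Sequence.IsRegular (MvPolynomial σ k ⧸ I) rs ∧
    (rs.length : WithBot ℕ∞) = ringKrullDim (MvPolynomial σ k ⧸ I)

variable (k : Type) [Field k]

/-- The homogeneous (saturated) vanishing ideal of a set of points of `ℙ^m`:
all polynomials vanishing on the affine cone over the points. -/
def vanishP {m : ℕ} (Z : Set (Pt k m)) : Ideal (MvPolynomial (Fin (m + 1)) k) :=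
  ⨅ (q : Pt k m) (_ : q ∈ Z) (s : k),
    RingHom.ker (MvPolynomial.eval (s • q.rep))

/-- The bihomogeneous (saturated) vanishing ideal of a set of points of `ℙ^a × ℙ^b`:
all polynomials vanishing on the multicone over the points. -/
def vanishP2 {a b : ℕ} (X : Set (Pt k a × Pt k b)) :
    Ideal (MvPolynomial (Fin (a + 1) ⊕ Fin (b + 1)) k) :=
  ⨅ (p : Pt k a × Pt k b) (_ : p ∈ X) (s : k) (t : k),
    RingHom.ker (MvPolynomial.eval (Sum.elim (s • p.1.rep) (t • p.2.rep)))

/-- The `(⋆)`-property for a finite set of points in `ℙ^a × ℙ^b`. -/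
def StarProp {a b : ℕ} (X : Set (Pt k a × Pt k b)) : Prop :=
  ∀ p ∈ X, ∀ q ∈ X, (p.1, q.2) ∈ X ∨ (q.1, p.2) ∈ X

open TensorProduct in
/-- A linear endomorphism of `B` with values in `J` maps `A ⊗ B` to the extension of `J`. -/
theorem lTensor_mem_map_includeRight {k A B : Type*} [Field k] [CommRing A] [CommRing B]
    [Algebra k A] [Algebra k B] {J : Ideal B} {q : B →ₗ[k] B} (hq : ∀ b, q b ∈ J)
    (f : A ⊗[k] B) :
    q.lTensor A f ∈
      J.map (Algebra.TensorProduct.includeRight : B →ₐ[k] A ⊗[k] B) := by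
  induction f with
  | zero => simp
  | add x y hx hy => rw [map_add]; exact add_mem hx hy
  | tmul a b =>
    have h := Ideal.mul_mem_left _ (a ⊗ₜ[k] (1 : B)) (Ideal.mem_map_of_mem
      (Algebra.TensorProduct.includeRight : B →ₐ[k] A ⊗[k] B) (hq b))
    simpa using h

/-- An ideal of an algebra over a field admits a linear projection onto it. -/
theorem Ideal.exists_linear_projection {k A : Type*} [Field k] [CommRing A] [Algebra k A]
    (I : Ideal A) : ∃ p : A →ₗ[k] A, (∀ a, p a ∈ I) ∧ ∀ a ∈ I, p a = a := by
  obtain ⟨p, hp⟩ := (I.restrictScalars k).subtype.exists_leftInverse_of_injective (by simp)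
  exact ⟨(I.restrictScalars k).subtype ∘ₗ p, fun a => (p a).2,
    fun a ha => congrArg Subtype.val (LinearMap.congr_fun hp ⟨a, ha⟩)⟩

open TensorProduct in
/-- Over a field, ideals extended from the two factors of a tensor product satisfy
`Iᵉ ∩ Jᵉ ⊆ Iᵉ Jᵉ`. -/
theorem map_includeLeft_inf_map_includeRight_le {k A B : Type*} [Field k] [CommRing A]
    [CommRing B] [Algebra k A] [Algebra k B] (I : Ideal A) (J : Ideal B) :
    I.map (Algebra.TensorProduct.includeLeft : A →ₐ[k] A ⊗[k] B) ⊓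
        J.map (Algebra.TensorProduct.includeRight : B →ₐ[k] A ⊗[k] B) ≤
      I.map (Algebra.TensorProduct.includeLeft : A →ₐ[k] A ⊗[k] B) *
        J.map (Algebra.TensorProduct.includeRight : B →ₐ[k] A ⊗[k] B) := by
  obtain ⟨p, hpI, hp⟩ := I.exists_linear_projection (k := k)
  obtain ⟨q, hqJ, hq⟩ := J.exists_linear_projection (k := k)
  rintro f ⟨hfI, hfJ⟩
  have hpf : p.rTensor B f = f := by
    obtain ⟨y, rfl⟩ := (Ideal.map_includeLeft_eq (R := k) (B := B) I).le hfI
    rw [← LinearMap.rTensor_comp_apply]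
    congr 2
    ext a
    exact hp a a.2
  have hqf : q.lTensor A f = f := by
    obtain ⟨y, rfl⟩ := (Ideal.map_includeRight_eq (R := k) (A := A) J).le hfJ
    rw [← LinearMap.lTensor_comp_apply]
    congr 2
    ext b
    exact hq b b.2
  have key : ∀ g : A ⊗[k] B, p.rTensor B (q.lTensor A g) ∈
      I.map (Algebra.TensorProduct.includeLeft : A →ₐ[k] A ⊗[k] B) *
        J.map (Algebra.TensorProduct.includeRight : B →ₐ[k] A ⊗[k] B) := by
    intro g
    induction g with
    | zero => simp
    | add x y hx hy => rw [map_add, map_add]; exact add_mem hx hy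
    | tmul a b =>
      have h := Ideal.mul_mem_mul
        (Ideal.mem_map_of_mem (Algebra.TensorProduct.includeLeft : A →ₐ[k] A ⊗[k] B) (hpI a))
        (Ideal.mem_map_of_mem (Algebra.TensorProduct.includeRight : B →ₐ[k] A ⊗[k] B) (hqJ b))
      simpa using h
  simpa [hqf, hpf] using key f

open TensorProduct in
/-- An element of `A ⊗ B` killed by all `u ⊗ w`, where `u`, `w` run through sets of characters
whose common kernels lie in `I` and `J`, belongs to `Iᵉ + Jᵉ`. -/
theorem mem_map_includeLeft_sup_map_includeRight {k A B : Type*} [Field k] [CommRing A]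
    [CommRing B] [Algebra k A] [Algebra k B] {I : Ideal A} {J : Ideal B}
    {S : Set (A →ₐ[k] k)} {T : Set (B →ₐ[k] k)}
    (hI : ∀ a, (∀ u ∈ S, u a = 0) → a ∈ I) (hJ : ∀ b, (∀ w ∈ T, w b = 0) → b ∈ J)
    {f : A ⊗[k] B} (hf : ∀ u ∈ S, ∀ w ∈ T, Algebra.TensorProduct.lift u w
      (fun _ _ => Commute.all _ _) f = 0) :
    f ∈ I.map (Algebra.TensorProduct.includeLeft : A →ₐ[k] A ⊗[k] B) ⊔
        J.map (Algebra.TensorProduct.includeRight : B →ₐ[k] A ⊗[k] B) := by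
  classical
  obtain ⟨q, hqJ, hq⟩ := J.exists_linear_projection (k := k)
  let r : B →ₗ[k] B := LinearMap.id - q
  have hsplit : f = r.lTensor A f + q.lTensor A f := by
    simp [r, LinearMap.lTensor_sub]
  let ev (u : A →ₐ[k] k) : A ⊗[k] B →ₗ[k] B :=
    (TensorProduct.lid k B).toLinearMap ∘ₗ u.toLinearMap.rTensor B
  have hev_w (u : A →ₐ[k] k) (w : B →ₐ[k] k) (g : A ⊗[k] B) : w (ev u g) =
      Algebra.TensorProduct.lift u w (fun _ _ => Commute.all _ _) g := by
    induction g with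
    | zero => simp
    | add x y hx hy => simp only [map_add, hx, hy]
    | tmul a b => simp [ev]
  have hev_r (u : A →ₐ[k] k) (g : A ⊗[k] B) : ev u (r.lTensor A g) = r (ev u g) := by
    induction g with
    | zero => simp
    | add x y hx hy => simp only [map_add, hx, hy]
    | tmul a b => simp [ev]
  have hzero : ∀ u ∈ S, ev u (r.lTensor A f) = 0 := by
    intro u hu
    have hmem : ev u f ∈ J := hJ _ fun w hw => (hev_w u w f).trans (hf u hu w hw)
    rw [hev_r]
    simp [r, hq _ hmem]
  let 𝒞 := Module.Basis.ofVectorSpace k B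
  have hcoeff (u : A →ₐ[k] k) (g : A ⊗[k] B) (i) :
      u (TensorProduct.equivFinsuppOfBasisRight 𝒞 g i) = 𝒞.repr (ev u g) i := by
    induction g with
    | zero => simp
    | add x y hx hy => simp only [map_add, Finsupp.add_apply, hx, hy]
    | tmul a b => simp [ev, mul_comm]
  have hleft : r.lTensor A f ∈
      I.map (Algebra.TensorProduct.includeLeft : A →ₐ[k] A ⊗[k] B) := by
    rw [← (TensorProduct.equivFinsuppOfBasisRight 𝒞).symm_apply_apply (r.lTensor A f),
      TensorProduct.equivFinsuppOfBasisRight_symm_apply]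
    refine Ideal.sum_mem _ fun i _ => ?_
    have ha : TensorProduct.equivFinsuppOfBasisRight 𝒞 (r.lTensor A f) i ∈ I :=
      hI _ fun u hu => by rw [hcoeff, hzero u hu]; simp
    have h := Ideal.mul_mem_right ((1 : A) ⊗ₜ[k] 𝒞 i) _ (Ideal.mem_map_of_mem
      (Algebra.TensorProduct.includeLeft : A →ₐ[k] A ⊗[k] B) ha)
    simpa using h
  rw [hsplit]
  exact Ideal.add_mem _ (Ideal.mem_sup_left hleft)
    (Ideal.mem_sup_right (lTensor_mem_map_includeRight hqJ f))

/-- For an increasing chain `I` and a decreasing chain `J` of ideals with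
`I (m + 1) ⊓ J m ≤ I (m + 1) * J m`, the intersection of the ideals `I m + J m` is
`I 0 + ∑ I (m + 1) * J m + J n`. -/
theorem iInf_sup_eq_add_sum_mul_add {R : Type*} [CommRing R] (I J : ℕ → Ideal R) (n : ℕ)
    (hI : ∀ p q, p ≤ q → q ≤ n → I p ≤ I q) (hJ : ∀ p q, p ≤ q → q ≤ n → J q ≤ J p)
    (hIJ : ∀ m < n, I (m + 1) ⊓ J m ≤ I (m + 1) * J m) :
    ⨅ m ≤ n, (I m ⊔ J m) = I 0 + ∑ m ∈ Finset.range n, I (m + 1) * J m + J n := by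
  apply le_antisymm
  · induction n with
    | zero => simp
    | succ n ih =>
      intro f hf
      have hf' : ∀ m ≤ n + 1, f ∈ I m ⊔ J m := fun m hm =>
        (iInf₂_le m hm : ⨅ m ≤ n + 1, (I m ⊔ J m) ≤ I m ⊔ J m) hf
      have hfn := ih (fun p q h hq => hI p q h (by lia)) (fun p q h hq => hJ p q h (by lia))
        (fun m hm => hIJ m (by lia))
        (show f ∈ ⨅ m ≤ n, (I m ⊔ J m) by
          simp only [Submodule.mem_iInf]
          exact fun m hm => hf' m (by lia))
      obtain ⟨g, hg, h, hh, rfl⟩ := Submodule.mem_sup.1 hfn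
      have hgI : g ∈ I (n + 1) := by
        refine (sup_le (hI 0 (n + 1) (by lia) le_rfl) ?_ :
          I 0 + ∑ m ∈ Finset.range n, I (m + 1) * J m ≤ I (n + 1)) hg
        rw [Ideal.sum_eq_sup]
        refine Finset.sup_le fun m hm => Ideal.mul_le_left.trans (hI _ _ ?_ le_rfl)
        have := Finset.mem_range.1 hm
        lia
      have hhIJ : h ∈ I (n + 1) ⊔ J (n + 1) :=
        (Submodule.add_mem_iff_right _ (Ideal.mem_sup_left hgI)).1 (hf' (n + 1) le_rfl)
      obtain ⟨x, hx, y, hy, rfl⟩ := Submodule.mem_sup.1 hhIJ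
      have hxJ : x ∈ J n :=
        (Submodule.add_mem_iff_left _ (hJ n (n + 1) (by lia) le_rfl hy)).1 hh
      have hxm := hIJ n (by lia) ⟨hx, hxJ⟩
      rw [Finset.sum_range_succ, ← add_assoc (I 0), ← add_assoc g]
      exact Submodule.add_mem_sup (Submodule.add_mem_sup hg hxm) hy
  · refine le_iInf₂ fun m hm => sup_le (sup_le ?_ ?_) ?_
    · exact (hI 0 m (by lia) hm).trans le_sup_left
    · rw [Ideal.sum_eq_sup]
      refine Finset.sup_le fun l hl => ?_
      have hl := Finset.mem_range.1 hl
      rcases Nat.lt_or_ge l m with h | h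
      · exact Ideal.mul_le_left.trans ((hI _ _ h hm).trans le_sup_left)
      · exact Ideal.mul_le_right.trans ((hJ _ _ h (by lia)).trans le_sup_right)
    · exact (hJ m n hm le_rfl).trans le_sup_right

namespace MvPolynomial

variable {σ τ : Type*}

theorem map_rename_inl_eq_map_tensorEquivSum (I : Ideal (MvPolynomial σ k)) :
    I.map (rename (Sum.inl : σ → σ ⊕ τ)) =
      (I.map (Algebra.TensorProduct.includeLeft :
        MvPolynomial σ k →ₐ[k] TensorProduct k (MvPolynomial σ k) (MvPolynomial τ k))).map
        (tensorEquivSum k σ τ k).toAlgHom := by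
  rw [Ideal.map_mapₐ]
  congr 1
  ext i : 1
  simp

theorem map_rename_inr_eq_map_tensorEquivSum (J : Ideal (MvPolynomial τ k)) :
    J.map (rename (Sum.inr : τ → σ ⊕ τ)) =
      (J.map (Algebra.TensorProduct.includeRight :
        MvPolynomial τ k →ₐ[k] TensorProduct k (MvPolynomial σ k) (MvPolynomial τ k))).map
        (tensorEquivSum k σ τ k).toAlgHom := by
  rw [Ideal.map_mapₐ]
  congr 1
  ext i : 1
  simp

theorem map_rename_inl_inf_map_rename_inr_le (I : Ideal (MvPolynomial σ k))
    (J : Ideal (MvPolynomial τ k)) :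
    I.map (rename (Sum.inl : σ → σ ⊕ τ)) ⊓ J.map (rename (Sum.inr : τ → σ ⊕ τ)) ≤
      I.map (rename (Sum.inl : σ → σ ⊕ τ)) * J.map (rename (Sum.inr : τ → σ ⊕ τ)) := by
  rw [map_rename_inl_eq_map_tensorEquivSum, map_rename_inr_eq_map_tensorEquivSum,
    ← Ideal.map_mul]
  rintro f ⟨hI, hJ⟩
  obtain ⟨x, hx, rfl⟩ := (Ideal.mem_map_of_equiv (tensorEquivSum k σ τ k) _).1 hI
  obtain ⟨y, hy, hxy⟩ := (Ideal.mem_map_of_equiv (tensorEquivSum k σ τ k) _).1 hJ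
  obtain rfl := (tensorEquivSum k σ τ k).injective hxy
  exact Ideal.mem_map_of_mem _ (map_includeLeft_inf_map_includeRight_le I J ⟨hx, hy⟩)

end MvPolynomial

theorem mem_vanishP {m : ℕ} {Z : Set (Pt k m)} {f : MvPolynomial (Fin (m + 1)) k} :
    f ∈ vanishP k Z ↔ ∀ q ∈ Z, ∀ s : k, MvPolynomial.eval (s • q.rep) f = 0 := by
  simp [vanishP, Submodule.mem_iInf, RingHom.mem_ker]

theorem mem_vanishP2 {a b : ℕ} {X : Set (Pt k a × Pt k b)}
    {f : MvPolynomial (Fin (a + 1) ⊕ Fin (b + 1)) k} :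
    f ∈ vanishP2 k X ↔ ∀ p ∈ X, ∀ s t : k,
      MvPolynomial.eval (Sum.elim (s • p.1.rep) (t • p.2.rep)) f = 0 := by
  simp only [vanishP2, Submodule.mem_iInf, RingHom.mem_ker]

theorem vanishP_anti {m : ℕ} {Y Z : Set (Pt k m)} (h : Y ⊆ Z) : vanishP k Z ≤ vanishP k Y :=
  fun _ hf => (mem_vanishP k).2 fun q hq => (mem_vanishP k).1 hf q (h hq)

/-- The ideal of a product of point sets is the sum of the extended ideals of the factors. -/
theorem vanishP2_prod {a b : ℕ} (V : Set (Pt k a)) (Z : Set (Pt k b)) :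
    vanishP2 k (V ×ˢ Z) =
      (vanishP k V).map (MvPolynomial.rename (Sum.inl : Fin (a + 1) → Fin (a + 1) ⊕ Fin (b + 1)))
        ⊔ (vanishP k Z).map
          (MvPolynomial.rename (Sum.inr : Fin (b + 1) → Fin (a + 1) ⊕ Fin (b + 1))) := by
  apply le_antisymm
  · intro f hf
    rw [mem_vanishP2] at hf
    obtain ⟨g, rfl⟩ := (MvPolynomial.tensorEquivSum k (Fin (a + 1)) (Fin (b + 1)) k).surjective f
    rw [MvPolynomial.map_rename_inl_eq_map_tensorEquivSum,
      MvPolynomial.map_rename_inr_eq_map_tensorEquivSum, ← Ideal.map_sup]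
    refine Ideal.mem_map_of_mem
      (MvPolynomial.tensorEquivSum k (Fin (a + 1)) (Fin (b + 1)) k).toAlgHom
      (mem_map_includeLeft_sup_map_includeRight
        (S := {u | ∃ q ∈ V, ∃ s : k, u = MvPolynomial.aeval (s • q.rep)})
        (T := {w | ∃ q ∈ Z, ∃ s : k, w = MvPolynomial.aeval (s • q.rep)}) ?_ ?_ ?_)
    · exact fun x hx => (mem_vanishP k).2 fun q hq s => hx _ ⟨q, hq, s, rfl⟩
    · exact fun x hx => (mem_vanishP k).2 fun q hq s => hx _ ⟨q, hq, s, rfl⟩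
    · rintro _ ⟨p, hp, s, rfl⟩ _ ⟨q, hq, t, rfl⟩
      rw [← hf (p, q) ⟨hp, hq⟩ s t]
      have h : Algebra.TensorProduct.lift (MvPolynomial.aeval (s • p.rep))
          (MvPolynomial.aeval (t • q.rep)) (fun _ _ => Commute.all _ _) =
          (MvPolynomial.aeval (R := k) (Sum.elim (s • p.rep) (t • q.rep))).comp
            (MvPolynomial.tensorEquivSum k (Fin (a + 1)) (Fin (b + 1)) k).toAlgHom := by
        ext i <;> simp
      exact DFunLike.congr_fun h g
  · refine sup_le (Ideal.map_le_iff_le_comap.2 fun f hf => ?_)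
      (Ideal.map_le_iff_le_comap.2 fun f hf => ?_)
    · rw [Ideal.mem_comap, mem_vanishP2]
      intro p hp s t
      simpa [MvPolynomial.eval_rename] using (mem_vanishP k).1 hf p.1 hp.1 s
    · rw [Ideal.mem_comap, mem_vanishP2]
      intro p hp s t
      simpa [MvPolynomial.eval_rename] using (mem_vanishP k).1 hf p.2 hp.2 t

/-- **Theorem (decomposition of the ideal of a `(⋆)`-configuration).**
Let `X ⊆ ℙ^{a₁} × ℙ^{a₂}` be a finite set of points with the `(⋆)`-property, organized (after
relabelling) by `U(X) = {(i₁,j₁), …, (i_t,j_t)}` with `i₁ > ⋯ > i_t` and `j₁ < ⋯ < j_t`, so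
that `X = {P_i × Q_j : (i,j) ≤ (i_m,j_m) for some m}`, and set
`V_m = {P_i : i ≤ i_m}`, `Z_m = {Q_j : j ≤ j_m}`.  Then (with `0`-based indexing `m = 0, …, t-1`)
`I_X = I_{V_1} + I_{V_2}·I_{Z_1} + ⋯ + I_{V_t}·I_{Z_{t-1}} + I_{Z_t}`. -/
theorem star_ideal_decomposition [CharZero k] {a b : ℕ} (t : ℕ) (ht : 0 < t)
    (ii jj : ℕ → ℕ)
    (hii : ∀ p q : ℕ, p < q → q < t → ii q < ii p)
    (hjj : ∀ p q : ℕ, p < q → q < t → jj p < jj q)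
    (P : ℕ → Pt k a) (Q : ℕ → Pt k b)
    (hP : Set.InjOn P (Set.Iic (ii 0))) (hQ : Set.InjOn Q (Set.Iic (jj (t - 1))))
    (X : Set (Pt k a × Pt k b))
    (hX : X = {x | ∃ i j m : ℕ, m < t ∧ i ≤ ii m ∧ j ≤ jj m ∧ x = (P i, Q j)}) :
    vanishP2 k X =
      Ideal.map (MvPolynomial.rename (Sum.inl : Fin (a + 1) → Fin (a + 1) ⊕ Fin (b + 1)))
        (vanishP k (P '' Set.Iic (ii 0))) +
      (∑ m ∈ Finset.range (t - 1),
        Ideal.map (MvPolynomial.rename (Sum.inl : Fin (a + 1) → Fin (a + 1) ⊕ Fin (b + 1)))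
            (vanishP k (P '' Set.Iic (ii (m + 1)))) *
          Ideal.map (MvPolynomial.rename (Sum.inr : Fin (b + 1) → Fin (a + 1) ⊕ Fin (b + 1)))
            (vanishP k (Q '' Set.Iic (jj m)))) +
      Ideal.map (MvPolynomial.rename (Sum.inr : Fin (b + 1) → Fin (a + 1) ⊕ Fin (b + 1)))
        (vanishP k (Q '' Set.Iic (jj (t - 1)))) := by
  have hanti : ∀ p q : ℕ, p ≤ q → q ≤ t - 1 → ii q ≤ ii p := fun p q hpq hq =>
    hpq.eq_or_lt.elim (fun h => h ▸ le_rfl) fun h => (hii p q h (by lia)).le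
  have hmono : ∀ p q : ℕ, p ≤ q → q ≤ t - 1 → jj p ≤ jj q := fun p q hpq hq =>
    hpq.eq_or_lt.elim (fun h => h ▸ le_rfl) fun h => (hjj p q h (by lia)).le
  have hXI : vanishP2 k X =
      ⨅ m ≤ t - 1, vanishP2 k ((P '' Set.Iic (ii m)) ×ˢ (Q '' Set.Iic (jj m))) := by
    subst hX
    ext f
    simp only [Submodule.mem_iInf, mem_vanishP2]
    constructor
    · rintro h m hm ⟨_, _⟩ ⟨⟨i, hi, rfl⟩, ⟨j, hj, rfl⟩⟩
      exact h _ ⟨i, j, m, by lia, hi, hj, rfl⟩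
    · rintro h _ ⟨i, j, m, hm, hi, hj, rfl⟩
      exact h m (by lia) _ ⟨⟨i, hi, rfl⟩, ⟨j, hj, rfl⟩⟩
  simp only [hXI, vanishP2_prod]
  exact iInf_sup_eq_add_sum_mul_add
    (fun m => (vanishP k (P '' Set.Iic (ii m))).map (MvPolynomial.rename Sum.inl))
    (fun m => (vanishP k (Q '' Set.Iic (jj m))).map (MvPolynomial.rename Sum.inr)) (t - 1)
    (fun p q hpq hq => Ideal.map_mono (vanishP_anti k
      (Set.image_mono (Set.Iic_subset_Iic.2 (hanti p q hpq hq)))))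
    (fun p q hpq hq => Ideal.map_mono (vanishP_anti k
      (Set.image_mono (Set.Iic_subset_Iic.2 (hmono p q hpq hq)))))
    (fun _ _ => MvPolynomial.map_rename_inl_inf_map_rename_inr_le k _ _)

end
end

section
/- If X ⊂ P^{a_1} × P^{a_2} is a finite set of points with the (⋆)-property, then X is arithmetically Cohen–Macaulay. -/
noncomputable section

variable (k : Type) [Field k]

section TensorFunctions

variable {k} {α β : Type}

/-- The bilinear map sending `v` and `w` to the function `(p, q) ↦ v p * w q`. -/
def tensorFun (k : Type) [Field k] (α β : Type) : (α → k) →ₗ[k] (β → k) →ₗ[k] (α → β → k) :=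
  LinearMap.mk₂ k (fun v w p q => v p * w q)
    (by intros; ext; simp [add_mul]) (by intros; ext; simp [mul_assoc])
    (by intros; ext; simp [mul_add]) (by intros; ext; simp [mul_left_comm])

/-- The span of all the functions `(p, q) ↦ v p * w q` with `v ∈ V` and `w ∈ W`. -/
def tensorSpan (V : Submodule k (α → k)) (W : Submodule k (β → k)) :
    Submodule k (α → β → k) :=
  Submodule.map₂ (tensorFun k α β) V W

lemma tensorSpan_mono {V V' : Submodule k (α → k)} {W W' : Submodule k (β → k)}
    (hV : V ≤ V') (hW : W ≤ W') : tensorSpan V W ≤ tensorSpan V' W' :=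
  Submodule.map₂_le_map₂ hV hW

lemma row_mem_of_mem_tensorSpan {V : Submodule k (α → k)} {W : Submodule k (β → k)}
    {f : α → β → k} (hf : f ∈ tensorSpan V W) (p : α) : f p ∈ W := by
  have h : tensorSpan V W ≤ W.comap (LinearMap.proj p) := by
    refine Submodule.map₂_le.2 fun v _ w hw => ?_
    exact W.smul_mem (v p) hw
  exact h hf

lemma column_mem_of_mem_tensorSpan {V : Submodule k (α → k)} {W : Submodule k (β → k)}
    {f : α → β → k} (hf : f ∈ tensorSpan V W) (q : β) : (fun p => f p q) ∈ V := by
  have h : tensorSpan V W ≤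
      V.comap (LinearMap.pi fun p => (LinearMap.proj q : (β → k) →ₗ[k] k) ∘ₗ
        (LinearMap.proj p : (α → β → k) →ₗ[k] (β → k))) := by
    refine Submodule.map₂_le.2 fun v hv w _ => ?_
    have hcol : (fun p => v p * w q) = w q • v := funext fun p => mul_comm _ _
    show (fun p => v p * w q) ∈ V
    exact hcol.symm ▸ V.smul_mem (w q) hv
  exact h hf

/-- Either a function in `V` separates `p` from the finite set `S`, or a function in `V` vanishing
on `S` also vanishes at `p`. -/
lemma exists_separator_or_vanishes (V : Submodule k (α → k)) (S : Finset α) (p : α) :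
    (∃ v ∈ V, v p = 1 ∧ ∀ s ∈ S, v s = 0) ∨ ∀ v ∈ V, (∀ s ∈ S, v s = 0) → v p = 0 := by
  by_cases h : ∀ v ∈ V, (∀ s ∈ S, v s = 0) → v p = 0
  · exact Or.inr h
  · push Not at h
    obtain ⟨v, hv, hS, hp⟩ := h
    exact Or.inl ⟨(v p)⁻¹ • v, V.smul_mem _ hv, by simp [hp], fun s hs => by simp [hS s hs]⟩

/-- Restricted to a union of rows with totally ordered fibres, the spaces `V' ⊗ W` and `V ⊗ W'`
intersect in `V ⊗ W`. -/
lemma exists_mem_tensorSpan_of_chain {V V' : Submodule k (α → k)} {W W' : Submodule k (β → k)}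
    (hV : V ≤ V') (hW : W ≤ W') (F : α → Set β) (hF : ∀ p p', F p ⊆ F p' ∨ F p' ⊆ F p)
    (S : Finset α) {g h : α → β → k} (hg : g ∈ tensorSpan V' W) (hh : h ∈ tensorSpan V W')
    (hgh : ∀ p ∈ S, ∀ q ∈ F p, g p q = h p q) :
    ∃ e ∈ tensorSpan V W, ∀ p ∈ S, ∀ q ∈ F p, g p q = e p q := by
  classical
  induction S using Finset.strongInduction with
  | H S ih =>
    rcases S.eq_empty_or_nonempty with rfl | hS
    · exact ⟨0, zero_mem _, by simp⟩
    obtain ⟨p, hpS, hpmin⟩ := S.finite_toSet.exists_minimalFor F _ hS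
    have hsub : ∀ p' ∈ S, F p ⊆ F p' := fun p' hp' =>
      (hF p p').elim id fun hle => hpmin hp' hle
    obtain ⟨e, he, hge⟩ := ih (S.erase p) (Finset.erase_ssubset hpS)
      fun p' hp' => hgh p' (Finset.mem_of_mem_erase hp')
    rcases exists_separator_or_vanishes V (S.erase p) p with ⟨v, hv, hvp, hvS⟩ | hvan
    · have hrow : (g - e) p ∈ W :=
        row_mem_of_mem_tensorSpan (sub_mem hg (tensorSpan_mono hV le_rfl he)) p
      refine ⟨e + tensorFun k α β v ((g - e) p),
        add_mem he (Submodule.apply_mem_map₂ _ hv hrow), fun p' hp' q hq => ?_⟩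
      by_cases hpp : p' = p
      · subst hpp
        simp [tensorFun, hvp]
      · have hmem : p' ∈ S.erase p := Finset.mem_erase.2 ⟨hpp, hp'⟩
        simp [tensorFun, hvS p' hmem, hge p' hmem q hq]
    · refine ⟨e, he, fun p' hp' q hq => ?_⟩
      by_cases hpp : p' = p
      · subst hpp
        have hcol := column_mem_of_mem_tensorSpan
          (sub_mem hh (tensorSpan_mono le_rfl hW he)) q
        have hzero := hvan _ hcol fun s hs => by
          have hsS := Finset.mem_of_mem_erase hs
          have hqs := hsub s hsS hq
          simp [← hgh s hsS q hqs, hge s hs q hqs]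
        rw [hgh p' hp' q hq]
        exact sub_eq_zero.1 hzero
      · exact hge p' (Finset.mem_erase.2 ⟨hpp, hp'⟩) q hq

end TensorFunctions

section Bihomogeneous

open MvPolynomial

variable {k} {σ τ α β : Type}

/-- Polynomials in two groups of variables that are homogeneous of degree `i` in the first group
and of degree `j` in the second. -/
def bihomogeneousSubmodule (σ τ k : Type) [Field k] (i j : ℕ) :
    Submodule k (MvPolynomial (σ ⊕ τ) k) :=
  Submodule.map₂
    ((LinearMap.mul k (MvPolynomial (σ ⊕ τ) k)).compl₁₂
      (rename (R := k) (Sum.inl : σ → σ ⊕ τ)).toLinearMap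
      (rename (R := k) (Sum.inr : τ → σ ⊕ τ)).toLinearMap)
    (homogeneousSubmodule σ k i) (homogeneousSubmodule τ k j)

/-- Evaluation of polynomials at a family of vectors. -/
def familyEval (u : α → σ → k) : MvPolynomial σ k →ₗ[k] (α → k) :=
  LinearMap.pi fun p => (aeval (u p)).toLinearMap

/-- Evaluation of polynomials in two groups of variables at a product of families of vectors. -/
def familyEval₂ (u : α → σ → k) (w : β → τ → k) :
    MvPolynomial (σ ⊕ τ) k →ₗ[k] (α → β → k) :=
  LinearMap.pi fun p => LinearMap.pi fun q => (aeval (Sum.elim (u p) (w q))).toLinearMap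

lemma familyEval_apply (u : α → σ → k) (F : MvPolynomial σ k) (p : α) :
    familyEval u F p = aeval (u p) F := rfl

lemma familyEval₂_apply (u : α → σ → k) (w : β → τ → k) (f : MvPolynomial (σ ⊕ τ) k)
    (p : α) (q : β) : familyEval₂ u w f p q = aeval (Sum.elim (u p) (w q)) f := rfl

/-- The functions on a family of vectors induced by forms of degree `i`. -/
def formFunctions (u : α → σ → k) (i : ℕ) : Submodule k (α → k) :=
  (homogeneousSubmodule σ k i).map (familyEval u)

lemma map_bihomogeneousSubmodule (u : α → σ → k) (w : β → τ → k) (i j : ℕ) :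
    (bihomogeneousSubmodule σ τ k i j).map (familyEval₂ u w) =
      tensorSpan (formFunctions u i) (formFunctions w j) := by
  rw [bihomogeneousSubmodule, tensorSpan, formFunctions, formFunctions, Submodule.map_map₂,
    Submodule.map₂_map_map]
  congr 1
  refine LinearMap.ext₂ fun F G => ?_
  ext p q
  simp only [LinearMap.compr₂_apply, LinearMap.compl₁₂_apply, LinearMap.mul_apply',
    AlgHom.toLinearMap_apply, familyEval_apply, familyEval₂_apply, tensorFun, LinearMap.mk₂_apply,
    map_mul, aeval_rename, Sum.elim_comp_inl, Sum.elim_comp_inr]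

lemma formFunctions_le_succ (u : α → σ → k) (ℓ : MvPolynomial σ k) (hℓ : ℓ.IsHomogeneous 1)
    (hu : ∀ p, aeval (u p) ℓ = 1) (i : ℕ) : formFunctions u i ≤ formFunctions u (i + 1) := by
  rintro _ ⟨F, hF, rfl⟩
  refine ⟨F * ℓ, (show F.IsHomogeneous i from hF).mul hℓ, ?_⟩
  ext p
  rw [familyEval_apply, familyEval_apply, map_mul, hu, mul_one]

lemma mul_mem_bihomogeneousSubmodule {F : MvPolynomial σ k} {G : MvPolynomial τ k} {i j : ℕ}
    (hF : F.IsHomogeneous i) (hG : G.IsHomogeneous j) :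
    rename Sum.inl F * rename Sum.inr G ∈ bihomogeneousSubmodule σ τ k i j :=
  Submodule.apply_mem_map₂
    ((LinearMap.mul k (MvPolynomial (σ ⊕ τ) k)).compl₁₂
      (rename (R := k) (Sum.inl : σ → σ ⊕ τ)).toLinearMap
      (rename (R := k) (Sum.inr : τ → σ ⊕ τ)).toLinearMap)
    (p := homogeneousSubmodule σ k i) (q := homogeneousSubmodule τ k j) hF hG

lemma iSup_bihomogeneousSubmodule :
    ⨆ d : ℕ × ℕ, bihomogeneousSubmodule σ τ k d.1 d.2 = ⊤ := by
  refine eq_top_iff.2 fun f _ => ?_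
  have hmem : ∀ {i j : ℕ} {F : MvPolynomial σ k} {G : MvPolynomial τ k}, F.IsHomogeneous i →
      G.IsHomogeneous j → rename Sum.inl F * rename Sum.inr G ∈
        ⨆ d : ℕ × ℕ, bihomogeneousSubmodule σ τ k d.1 d.2 := fun {i j _ _} hF hG =>
    Submodule.mem_iSup_of_mem (i, j) (mul_mem_bihomogeneousSubmodule hF hG)
  induction f using MvPolynomial.induction_on with
  | C a => simpa using hmem (isHomogeneous_C σ a) (isHomogeneous_one τ k)
  | add f g hf hg => exact add_mem (hf trivial) (hg trivial)
  | mul_X f n hf =>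
    have hle : ⨆ d : ℕ × ℕ, bihomogeneousSubmodule σ τ k d.1 d.2 ≤
        (⨆ d : ℕ × ℕ, bihomogeneousSubmodule σ τ k d.1 d.2).comap
          (LinearMap.mulRight k (X n)) := by
      refine iSup_le fun d => Submodule.map₂_le.2 fun F hF G hG => ?_
      rw [mem_homogeneousSubmodule] at hF hG
      rcases n with n | n
      · have h := hmem (hF.mul (isHomogeneous_X k n)) hG
        rw [map_mul, rename_X, mul_right_comm] at h
        exact h
      · have h := hmem hF (hG.mul (isHomogeneous_X k n))
        rw [map_mul, rename_X, ← mul_assoc] at h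
        exact h
    exact hle (hf trivial)

/-- Restriction of polynomials to the plane `{(s • u, t • w)}` with coordinates `s` and `t`. -/
def planeRestriction (u : σ → k) (w : τ → k) :
    MvPolynomial (σ ⊕ τ) k →ₐ[k] MvPolynomial (Fin 2) k :=
  aeval (Sum.elim (fun i => C (u i) * X 0) (fun j => C (w j) * X 1))

lemma eval_planeRestriction (u : σ → k) (w : τ → k) (f : MvPolynomial (σ ⊕ τ) k)
    (x : Fin 2 → k) :
    eval x (planeRestriction u w f) = eval (Sum.elim (x 0 • u) (x 1 • w)) f := by
  induction f using MvPolynomial.induction_on with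
  | C a => simp [planeRestriction]
  | add f g hf hg => simp [hf, hg]
  | mul_X f n hf =>
    rcases n with n | n <;> simp [hf] <;> simp [planeRestriction, mul_comm]

lemma mem_ker_planeRestriction [Infinite k] (u : σ → k) (w : τ → k)
    (f : MvPolynomial (σ ⊕ τ) k) :
    f ∈ RingHom.ker (planeRestriction u w) ↔ ∀ s t : k, eval (Sum.elim (s • u) (t • w)) f = 0 := by
  rw [RingHom.mem_ker]
  refine ⟨fun h s t => ?_, fun h => MvPolynomial.funext fun x => ?_⟩
  · simpa [h] using (eval_planeRestriction u w f ![s, t]).symm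
  · simp [eval_planeRestriction, h]

lemma aeval_mul_of_isHomogeneous {F : MvPolynomial σ k} {i : ℕ} (hF : F.IsHomogeneous i)
    {A : Type} [CommRing A] [Algebra k A] (u : σ → k) (x : A) :
    aeval (fun n => algebraMap k A (u n) * x) F = algebraMap k A (aeval u F) * x ^ i := by
  rw [aeval_def, aeval_def, eval₂_eq, eval₂_eq, map_sum, Finset.sum_mul]
  refine Finset.sum_congr rfl fun d hd => ?_
  have hdeg : ∑ n ∈ d.support, d n = i := by
    have := hF (mem_support_iff.1 hd)
    rwa [Finsupp.weight_apply, Finsupp.sum, Finset.sum_congr rfl fun n _ => by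
      show d n • (1 : σ → ℕ) n = d n
      simp] at this
  simp_rw [mul_pow, Finset.prod_mul_distrib, Finset.prod_pow_eq_pow_sum, hdeg]
  simp [mul_assoc]

lemma planeRestriction_of_mem {f : MvPolynomial (σ ⊕ τ) k} {i j : ℕ}
    (hf : f ∈ bihomogeneousSubmodule σ τ k i j) (u : σ → k) (w : τ → k) :
    planeRestriction u w f =
      monomial (Finsupp.single 0 i + Finsupp.single 1 j) (aeval (Sum.elim u w) f) := by
  have hle : bihomogeneousSubmodule σ τ k i j ≤
      LinearMap.eqLocus (planeRestriction u w).toLinearMap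
        ((monomial (Finsupp.single 0 i + Finsupp.single 1 j)) ∘ₗ
          (aeval (Sum.elim u w)).toLinearMap) := by
    refine Submodule.map₂_le.2 fun F hF G hG => ?_
    rw [mem_homogeneousSubmodule] at hF hG
    have h₁ := aeval_mul_of_isHomogeneous hF u (X 0 : MvPolynomial (Fin 2) k)
    have h₂ := aeval_mul_of_isHomogeneous hG w (X 1 : MvPolynomial (Fin 2) k)
    simp only [algebraMap_eq] at h₁ h₂
    simp only [LinearMap.mem_eqLocus, LinearMap.compl₁₂_apply, LinearMap.mul_apply',
      AlgHom.toLinearMap_apply, LinearMap.comp_apply, map_mul, planeRestriction, aeval_rename,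
      Sum.elim_comp_inl, Sum.elim_comp_inr, h₁, h₂]
    simp only [X_pow_eq_monomial, C_mul_monomial, monomial_mul, mul_one]
  exact hle hf

lemma coeff_planeRestriction_sum {F : ℕ × ℕ →₀ MvPolynomial (σ ⊕ τ) k}
    (hF : ∀ d, F d ∈ bihomogeneousSubmodule σ τ k d.1 d.2) (u : σ → k) (w : τ → k) (i j : ℕ) :
    coeff (Finsupp.single 0 i + Finsupp.single 1 j)
      (planeRestriction u w (F.sum fun _ f => f)) = aeval (Sum.elim u w) (F (i, j)) := by
  classical
  rw [Finsupp.sum, map_sum, coeff_sum, Finset.sum_eq_single (i, j)]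
  · simp [planeRestriction_of_mem (hF (i, j))]
  · intro d _ hd
    rw [planeRestriction_of_mem (hF d), coeff_monomial, if_neg]
    intro h
    refine hd (Prod.ext ?_ ?_)
    · simpa using DFunLike.congr_fun h 0
    · simpa using DFunLike.congr_fun h 1
  · intro h
    simp [Finsupp.notMem_support_iff.1 h]

end Bihomogeneous

section Dimension

/-- The Krull dimension of the quotient by a finite intersection of ideals is bounded by the Krull
dimensions of the quotients by these ideals. -/
lemma ringKrullDim_quotient_finset_inf_le {R ι : Type} [CommRing R] (s : Finset ι)
    (I : ι → Ideal R) (n : WithBot ℕ∞) (h : ∀ i ∈ s, ringKrullDim (R ⧸ I i) ≤ n) :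
    ringKrullDim (R ⧸ s.inf I) ≤ n := by
  rw [ringKrullDim_quotient]
  refine iSup_le fun p => ?_
  obtain ⟨i, hi, hle⟩ := (p.head.1.isPrime.inf_le').1 p.head.2
  refine le_trans ?_ (h i hi)
  rw [ringKrullDim_quotient]
  let q : LTSeries (PrimeSpectrum.zeroLocus (R := R) (I i)) :=
    { length := p.length
      toFun := fun j => ⟨(p j).1, fun _ hx => (LTSeries.head_le p j) (hle hx)⟩
      step := fun j => p.step j }
  exact le_iSup (fun q : LTSeries _ => (q.length : WithBot ℕ∞)) q

end Dimension

section RegularPair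

lemma isRegular_pair_quotient {R : Type} [CommRing R] (I : Ideal R) (a b : R)
    (ha : ∀ f, a * f ∈ I → f ∈ I) (hb : ∀ f h, b * f - a * h ∈ I → f ∈ I ⊔ Ideal.span {a})
    (hab : I ⊔ Ideal.span {a, b} ≠ ⊤) :
    RingTheory.Sequence.IsRegular (R ⧸ I) [Ideal.Quotient.mk I a, Ideal.Quotient.mk I b] := by
  refine ⟨?_, ?_⟩
  · rw [RingTheory.Sequence.isWeaklyRegular_cons_iff,
      RingTheory.Sequence.isWeaklyRegular_singleton_iff]
    constructor
    · rw [isSMulRegular_iff_right_eq_zero_of_smul]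
      intro x hx
      obtain ⟨f, rfl⟩ := Ideal.Quotient.mk_surjective x
      rw [smul_eq_mul, ← map_mul, Ideal.Quotient.eq_zero_iff_mem] at hx
      exact Ideal.Quotient.eq_zero_iff_mem.2 (ha f hx)
    · refine (isSMulRegular_quotient_iff_mem_of_smul_mem _ _).2 fun x hx => ?_
      obtain ⟨f, rfl⟩ := Ideal.Quotient.mk_surjective x
      obtain ⟨y, -, hy⟩ := (Submodule.mem_smul_pointwise_iff_exists _ _ _).1 hx
      obtain ⟨h, rfl⟩ := Ideal.Quotient.mk_surjective y
      rw [smul_eq_mul, smul_eq_mul, ← map_mul, ← map_mul, eq_comm, Ideal.Quotient.eq] at hy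
      obtain ⟨g, hg, c, hc, hgc⟩ := Submodule.mem_sup.1 (hb f h hy)
      obtain ⟨e, rfl⟩ := Ideal.mem_span_singleton'.1 hc
      refine (Submodule.mem_smul_pointwise_iff_exists _ _ _).2
        ⟨Ideal.Quotient.mk I e, trivial, ?_⟩
      rw [smul_eq_mul, ← map_mul, ← hgc, map_add, Ideal.Quotient.eq_zero_iff_mem.2 hg, zero_add,
        mul_comm]
  · intro h
    refine hab (Ideal.eq_top_iff_one _ |>.2 ?_)
    have hone : (1 : R ⧸ I) ∈ Ideal.map (Ideal.Quotient.mk I) (Ideal.span {a, b}) := by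
      have h1 : (1 : R ⧸ I) ∈ Ideal.ofList [Ideal.Quotient.mk I a, Ideal.Quotient.mk I b] •
          (⊤ : Submodule (R ⧸ I) (R ⧸ I)) := h ▸ trivial
      rw [smul_eq_mul, Ideal.mul_top] at h1
      rw [Ideal.map_span, Set.image_pair]
      convert h1 using 2
      ext x
      simp
    obtain ⟨c, hc, hc1⟩ := (Ideal.mem_map_iff_of_surjective _ Ideal.Quotient.mk_surjective).1 hone
    rw [← map_one (Ideal.Quotient.mk I), Ideal.Quotient.eq] at hc1
    rw [← sub_sub_cancel c 1]
    exact sub_mem (Ideal.mem_sup_right hc) (Ideal.mem_sup_left hc1)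

end RegularPair

section PointsIdeal

open MvPolynomial

variable {k} {σ τ α β : Type}

/-- The ideal of the polynomials vanishing on the planes spanned by the vectors `u p` and `w q`
for all `(p, q) ∈ X`. -/
def planesIdeal (u : α → σ → k) (w : β → τ → k) (X : Set (α × β)) :
    Ideal (MvPolynomial (σ ⊕ τ) k) :=
  ⨅ x ∈ X, RingHom.ker (planeRestriction (u x.1) (w x.2))

lemma mem_planesIdeal {u : α → σ → k} {w : β → τ → k} {X : Set (α × β)}
    {f : MvPolynomial (σ ⊕ τ) k} :
    f ∈ planesIdeal u w X ↔ ∀ x ∈ X, planeRestriction (u x.1) (w x.2) f = 0 := by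
  simp [planesIdeal, Submodule.mem_iInf, RingHom.mem_ker]

lemma mem_planesIdeal_of_mem_bihomogeneousSubmodule {u : α → σ → k} {w : β → τ → k}
    {X : Set (α × β)} {f : MvPolynomial (σ ⊕ τ) k} {i j : ℕ}
    (hf : f ∈ bihomogeneousSubmodule σ τ k i j)
    (h : ∀ x ∈ X, aeval (Sum.elim (u x.1) (w x.2)) f = 0) : f ∈ planesIdeal u w X :=
  mem_planesIdeal.2 fun x hx => by rw [planeRestriction_of_mem hf, h x hx, map_zero]

lemma planeRestriction_rename_inl {ℓ : MvPolynomial σ k} (hℓ : ℓ.IsHomogeneous 1) {u : σ → k}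
    (hu : aeval u ℓ = 1) (w : τ → k) : planeRestriction u w (rename Sum.inl ℓ) = X 0 := by
  have h := aeval_mul_of_isHomogeneous hℓ u (X 0 : MvPolynomial (Fin 2) k)
  rw [hu, map_one, one_mul, pow_one, algebraMap_eq] at h
  rw [planeRestriction, aeval_rename, Sum.elim_comp_inl, h]

lemma planeRestriction_rename_inr {m : MvPolynomial τ k} (hm : m.IsHomogeneous 1) {w : τ → k}
    (hw : aeval w m = 1) (u : σ → k) : planeRestriction u w (rename Sum.inr m) = X 1 := by
  have h := aeval_mul_of_isHomogeneous hm w (X 1 : MvPolynomial (Fin 2) k)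
  rw [hw, map_one, one_mul, pow_one, algebraMap_eq] at h
  rw [planeRestriction, aeval_rename, Sum.elim_comp_inr, h]

lemma planeRestriction_surjective {ℓ : MvPolynomial σ k} (hℓ : ℓ.IsHomogeneous 1) {u : σ → k}
    (hu : aeval u ℓ = 1) {m : MvPolynomial τ k} (hm : m.IsHomogeneous 1) {w : τ → k}
    (hw : aeval w m = 1) : Function.Surjective (planeRestriction u w) := by
  intro g
  refine ⟨aeval ![rename Sum.inl ℓ, rename Sum.inr m] g, ?_⟩
  have h : (planeRestriction u w).comp (aeval ![rename Sum.inl ℓ, rename Sum.inr m]) =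
      AlgHom.id k (MvPolynomial (Fin 2) k) := by
    ext n : 1
    fin_cases n
    · simpa using planeRestriction_rename_inl hℓ hu w
    · simpa using planeRestriction_rename_inr hm hw u
  exact DFunLike.congr_fun h g

lemma ringKrullDim_quotient_planesIdeal {u : α → σ → k} {w : β → τ → k} {X : Set (α × β)}
    (hfin : X.Finite) (hne : X.Nonempty)
    {ℓ : MvPolynomial σ k} (hℓ : ℓ.IsHomogeneous 1) (hu : ∀ p, aeval (u p) ℓ = 1)
    {m : MvPolynomial τ k} (hm : m.IsHomogeneous 1) (hw : ∀ q, aeval (w q) m = 1) :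
    ringKrullDim (MvPolynomial (σ ⊕ τ) k ⧸ planesIdeal u w X) = 2 := by
  have hplane : ringKrullDim (MvPolynomial (Fin 2) k) = 2 := by
    simp [MvPolynomial.ringKrullDim_of_isNoetherianRing]
  have hsurj (x : α × β) := planeRestriction_surjective hℓ (hu x.1) hm (hw x.2)
  have heq : planesIdeal u w X =
      hfin.toFinset.inf fun x => RingHom.ker (planeRestriction (u x.1) (w x.2)) := by
    simp [planesIdeal, Finset.inf_eq_iInf]
  refine le_antisymm ?_ ?_
  · rw [heq]
    refine ringKrullDim_quotient_finset_inf_le _ _ _ fun x _ => ?_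
    exact ((ringKrullDim_eq_of_ringEquiv
      (Ideal.quotientKerAlgEquivOfSurjective (hsurj x)).toRingEquiv).trans hplane).le
  · obtain ⟨x, hx⟩ := hne
    rw [← hplane]
    refine ringKrullDim_le_of_surjective (Ideal.Quotient.lift (planesIdeal u w X)
      (planeRestriction (u x.1) (w x.2)).toRingHom fun f hf => mem_planesIdeal.1 hf x hx) ?_
    exact Ideal.Quotient.lift_surjective_of_surjective _ _ (hsurj x)

lemma mem_planesIdeal_of_mul_mem {u : α → σ → k} {w : β → τ → k} {X : Set (α × β)}
    {ℓ : MvPolynomial σ k} (hℓ : ℓ.IsHomogeneous 1) (hu : ∀ p, aeval (u p) ℓ = 1)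
    {f : MvPolynomial (σ ⊕ τ) k} (hf : rename Sum.inl ℓ * f ∈ planesIdeal u w X) :
    f ∈ planesIdeal u w X := by
  refine mem_planesIdeal.2 fun x hx => ?_
  have h := mem_planesIdeal.1 hf x hx
  rw [map_mul, planeRestriction_rename_inl hℓ (hu x.1)] at h
  exact (mul_eq_zero.1 h).resolve_left (X_ne_zero 0)

/-- If the fibres of `X` over the first factor form a chain, then a linear form in the second group
of variables is a nonzerodivisor modulo the ideal of `X` and a linear form in the first group. -/
lemma mem_sup_of_mul_sub_mul_mem {u : α → σ → k} {w : β → τ → k} {X : Set (α × β)}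
    (hfin : X.Finite)
    (hX : ∀ p p', (∀ q, (p, q) ∈ X → (p', q) ∈ X) ∨ ∀ q, (p', q) ∈ X → (p, q) ∈ X)
    {ℓ : MvPolynomial σ k} (hℓ : ℓ.IsHomogeneous 1) (hu : ∀ p, aeval (u p) ℓ = 1)
    {m : MvPolynomial τ k} (hm : m.IsHomogeneous 1) (hw : ∀ q, aeval (w q) m = 1)
    {f h : MvPolynomial (σ ⊕ τ) k}
    (hfh : rename Sum.inr m * f - rename Sum.inl ℓ * h ∈ planesIdeal u w X) :
    f ∈ planesIdeal u w X ⊔ Ideal.span {rename Sum.inl ℓ} := by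
  classical
  have hdecomp (g : MvPolynomial (σ ⊕ τ) k) := (Submodule.mem_iSup_iff_exists_finsupp
    (fun d : ℕ × ℕ => bihomogeneousSubmodule σ τ k d.1 d.2) g).1
      (iSup_bihomogeneousSubmodule (σ := σ) (τ := τ) (k := k) ▸ trivial)
  obtain ⟨F, hF, rfl⟩ := hdecomp f
  obtain ⟨H, hH, rfl⟩ := hdecomp h
  have hrel : ∀ x ∈ X,
      MvPolynomial.X 1 * planeRestriction (u x.1) (w x.2) (F.sum fun _ f => f) =
        MvPolynomial.X 0 * planeRestriction (u x.1) (w x.2) (H.sum fun _ f => f) := by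
    intro x hx
    have := mem_planesIdeal.1 hfh x hx
    rwa [map_sub, map_mul, map_mul, planeRestriction_rename_inl hℓ (hu x.1),
      planeRestriction_rename_inr hm (hw x.2), sub_eq_zero] at this
  have hzero : ∀ j, ∀ x ∈ X, aeval (Sum.elim (u x.1) (w x.2)) (F (0, j)) = 0 := by
    intro j x hx
    have := congrArg (coeff (Finsupp.single 1 1 + (Finsupp.single 0 0 + Finsupp.single 1 j)))
      (hrel x hx)
    rw [coeff_X_mul, coeff_planeRestriction_sum hF, coeff_X_mul', if_neg (by simp)] at this
    exact this
  have hsucc : ∀ i j, ∀ x ∈ X, aeval (Sum.elim (u x.1) (w x.2)) (F (i + 1, j)) =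
      aeval (Sum.elim (u x.1) (w x.2)) (H (i, j + 1)) := by
    intro i j x hx
    have := congrArg (coeff (Finsupp.single 1 1 + (Finsupp.single 0 (i + 1) + Finsupp.single 1 j)))
      (hrel x hx)
    rwa [coeff_X_mul, coeff_planeRestriction_sum hF,
      show (Finsupp.single 1 1 + (Finsupp.single 0 (i + 1) + Finsupp.single 1 j) : Fin 2 →₀ ℕ) =
        Finsupp.single 0 1 + (Finsupp.single 0 i + Finsupp.single 1 (j + 1)) by
          simp only [Finsupp.single_add]; abel,
      coeff_X_mul, coeff_planeRestriction_sum hH] at this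
  refine Ideal.sum_mem _ fun ⟨i, j⟩ _ => ?_
  rcases i with _ | i
  · exact Ideal.mem_sup_left
      (mem_planesIdeal_of_mem_bihomogeneousSubmodule (hF (0, j)) (hzero j))
  · have hFmem : familyEval₂ u w (F (i + 1, j)) ∈
        tensorSpan (formFunctions u (i + 1)) (formFunctions w j) :=
      map_bihomogeneousSubmodule u w (i + 1) j ▸ Submodule.mem_map_of_mem (hF (i + 1, j))
    have hHmem : familyEval₂ u w (H (i, j + 1)) ∈
        tensorSpan (formFunctions u i) (formFunctions w (j + 1)) :=
      map_bihomogeneousSubmodule u w i (j + 1) ▸ Submodule.mem_map_of_mem (hH (i, j + 1))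
    obtain ⟨e, he, hFe⟩ := exists_mem_tensorSpan_of_chain
      (formFunctions_le_succ u ℓ hℓ hu i) (formFunctions_le_succ w m hm hw j)
      (fun p => {q | (p, q) ∈ X}) hX (hfin.image Prod.fst).toFinset hFmem hHmem
      (fun p _ q hq => hsucc i j (p, q) hq)
    rw [← map_bihomogeneousSubmodule] at he
    obtain ⟨E, hE, rfl⟩ := he
    have hℓE : rename Sum.inl ℓ * E ∈ bihomogeneousSubmodule σ τ k (i + 1) j := by
      have hle : bihomogeneousSubmodule σ τ k i j ≤
          (bihomogeneousSubmodule σ τ k (i + 1) j).comap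
            (LinearMap.mulLeft k (rename Sum.inl ℓ)) := by
        refine Submodule.map₂_le.2 fun A hA B hB => ?_
        have hmem := mul_mem_bihomogeneousSubmodule (hℓ.mul hA) hB
        rw [map_mul, mul_assoc, add_comm] at hmem
        exact hmem
      exact hle hE
    rw [← sub_add_cancel (F (i + 1, j)) (rename Sum.inl ℓ * E)]
    refine add_mem (Ideal.mem_sup_left (mem_planesIdeal_of_mem_bihomogeneousSubmodule
      (sub_mem (hF (i + 1, j)) hℓE) fun x hx => ?_))
      (Ideal.mem_sup_right (Ideal.mul_mem_right _ _ (Ideal.mem_span_singleton_self _)))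
    have hx' := hFe x.1 (by simpa using ⟨x.2, hx⟩) x.2 hx
    rw [familyEval₂_apply, familyEval₂_apply] at hx'
    rw [map_sub, map_mul, aeval_rename, Sum.elim_comp_inl, hu, one_mul, hx', sub_self]

lemma constantCoeff_eq_zero_of_mem_planesIdeal {u : α → σ → k} {w : β → τ → k} {X : Set (α × β)}
    (hne : X.Nonempty) {f : MvPolynomial (σ ⊕ τ) k} (hf : f ∈ planesIdeal u w X) :
    constantCoeff f = 0 := by
  obtain ⟨x, hx⟩ := hne
  have h := eval_planeRestriction (u x.1) (w x.2) f 0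
  rw [mem_planesIdeal.1 hf x hx, map_zero] at h
  simpa [constantCoeff_eq, ← eval_zero, Sum.elim_zero_zero] using h.symm

/-- The linear form with the given coefficients. -/
def linearForm {ι : Type} [Fintype ι] (c : ι → k) : MvPolynomial ι k := ∑ i, C (c i) * X i

lemma isHomogeneous_linearForm {ι : Type} [Fintype ι] (c : ι → k) :
    (linearForm c).IsHomogeneous 1 :=
  IsHomogeneous.sum _ _ _ fun i _ => by
    simpa using (isHomogeneous_C ι (c i)).mul (isHomogeneous_X k i)

lemma rename_linearForm_mem_span {ι κ : Type} [Fintype ι] (c : ι → k) (g : ι → κ) :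
    rename g (linearForm c) ∈ Ideal.span (Set.range (X : κ → MvPolynomial κ k)) := by
  rw [linearForm, map_sum]
  refine Ideal.sum_mem _ fun i _ => ?_
  rw [map_mul, rename_X]
  exact Ideal.mul_mem_left _ _ (Ideal.subset_span ⟨g i, rfl⟩)

/-- A finite set of points with affine representatives normalised by linear forms is
arithmetically Cohen–Macaulay if its fibres over the first factor form a chain. -/
lemma isACM_planesIdeal [Fintype σ] [Fintype τ] {u : α → σ → k} {w : β → τ → k}
    {X : Set (α × β)} (hfin : X.Finite) (hne : X.Nonempty)
    (hX : ∀ p p', (∀ q, (p, q) ∈ X → (p', q) ∈ X) ∨ ∀ q, (p', q) ∈ X → (p, q) ∈ X)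
    (c : σ → k) (hu : ∀ p, aeval (u p) (linearForm c) = 1)
    (d : τ → k) (hw : ∀ q, aeval (w q) (linearForm d) = 1) :
    IsACM (planesIdeal u w X) := by
  have hc := isHomogeneous_linearForm c
  have hd := isHomogeneous_linearForm d
  refine ⟨[Ideal.Quotient.mk _ (rename Sum.inl (linearForm c)),
    Ideal.Quotient.mk _ (rename Sum.inr (linearForm d))], ?_, ?_, ?_⟩
  · intro r hr
    simp only [List.mem_cons, List.not_mem_nil, or_false] at hr
    rcases hr with rfl | rfl <;>
      exact Ideal.mem_map_of_mem _ (rename_linearForm_mem_span _ _)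
  · refine isRegular_pair_quotient _ _ _ (fun f hf => mem_planesIdeal_of_mul_mem hc hu hf)
      (fun f h hfh => mem_sup_of_mul_sub_mul_mem hfin hX hc hu hd hw hfh) fun htop => ?_
    have hle : planesIdeal u w X ⊔ Ideal.span {rename Sum.inl (linearForm c),
        rename Sum.inr (linearForm d)} ≤ RingHom.ker (constantCoeff (R := k)) := by
      refine sup_le (fun f hf => constantCoeff_eq_zero_of_mem_planesIdeal hne hf)
        (Ideal.span_le.2 ?_)
      rintro _ (rfl | rfl) <;> simp [RingHom.mem_ker, linearForm]
    have hone : (1 : MvPolynomial (σ ⊕ τ) k) ∈ RingHom.ker (constantCoeff (R := k)) :=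
      hle (htop ▸ trivial)
    simp [RingHom.mem_ker] at hone
  · rw [ringKrullDim_quotient_planesIdeal hfin hne hc hu hd hw]
    rfl

end PointsIdeal

section Representatives

open MvPolynomial

variable {k}

/-- Finitely many points of projective space avoid a hyperplane, so that their representatives can
be normalised by a linear form. -/
lemma exists_normalized_representatives [Infinite k] {m : ℕ} (Z : Set (Pt k m)) (hZ : Z.Finite) :
    ∃ (c : Fin (m + 1) → k) (u : Pt k m → Fin (m + 1) → k),
      (∀ p, aeval (u p) (linearForm c) = 1) ∧ ∀ p ∈ Z, ∃ a : k, a ≠ 0 ∧ p.rep = a • u p := by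
  classical
  have := hZ.to_subtype
  obtain ⟨φ, hφ⟩ := Module.exists_dual_forall_apply_ne_zero (K := k)
    (fun o : Option Z => o.elim (fun _ => (1 : k)) fun p => p.1.rep)
    (by rintro (_ | p)
        · exact fun h => one_ne_zero (congrFun h 0)
        · exact p.1.rep_nonzero)
  have hform (v : Fin (m + 1) → k) :
      aeval v (linearForm fun i => φ (Pi.single i 1)) = φ v := by
    conv_rhs => rw [pi_eq_sum_univ' v]
    simp [linearForm, mul_comm]
  let r (p : Pt k m) : Fin (m + 1) → k := if φ p.rep = 0 then fun _ => 1 else p.rep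
  have hr (p : Pt k m) : φ (r p) ≠ 0 := by
    by_cases h : φ p.rep = 0
    · simpa [r, h] using hφ none
    · simp [r, h]
  refine ⟨fun i => φ (Pi.single i 1), fun p => (φ (r p))⁻¹ • r p, fun p => ?_, fun p hp => ?_⟩
  · rw [hform, map_smul, smul_eq_mul, inv_mul_cancel₀ (hr p)]
  · have hrp : r p = p.rep := if_neg (hφ (some ⟨p, hp⟩))
    refine ⟨φ (r p), hr p, ?_⟩
    rw [smul_smul, mul_inv_cancel₀ (hr p), one_smul, hrp]

lemma vanishP2_eq_planesIdeal [Infinite k] {a b : ℕ} (X : Set (Pt k a × Pt k b))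
    (u : Pt k a → Fin (a + 1) → k) (w : Pt k b → Fin (b + 1) → k)
    (hu : ∀ x ∈ X, ∃ c : k, c ≠ 0 ∧ x.1.rep = c • u x.1)
    (hw : ∀ x ∈ X, ∃ c : k, c ≠ 0 ∧ x.2.rep = c • w x.2) :
    vanishP2 k X = planesIdeal u w X := by
  refine iInf_congr fun x => iInf_congr fun hx => ?_
  obtain ⟨c, hc, hcx⟩ := hu x hx
  obtain ⟨d, hd, hdx⟩ := hw x hx
  ext f
  rw [mem_ker_planeRestriction]
  simp only [Submodule.mem_iInf, RingHom.mem_ker, hcx, hdx, smul_smul]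
  refine ⟨fun h s t => ?_, fun h s t => h _ _⟩
  have := h (s * c⁻¹) (t * d⁻¹)
  rwa [inv_mul_cancel_right₀ hc, inv_mul_cancel_right₀ hd] at this

end Representatives

/-- **Theorem (star implies ACM).** If `X ⊆ ℙ^{a₁} × ℙ^{a₂}` is a finite set of points with
the `(⋆)`-property, then `X` is arithmetically Cohen–Macaulay. -/
theorem star_implies_ACM [CharZero k] {a b : ℕ} (X : Set (Pt k a × Pt k b))
    (hfin : X.Finite) (hne : X.Nonempty) (hstar : StarProp k X) :
    IsACM (vanishP2 k X) := by
  obtain ⟨c, u, hu, huX⟩ := exists_normalized_representatives (Prod.fst '' X) (hfin.image _)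
  obtain ⟨d, w, hw, hwX⟩ := exists_normalized_representatives (Prod.snd '' X) (hfin.image _)
  rw [vanishP2_eq_planesIdeal X u w (fun x hx => huX _ ⟨x, hx, rfl⟩)
    fun x hx => hwX _ ⟨x, hx, rfl⟩]
  refine isACM_planesIdeal hfin hne (fun p p' => ?_) c hu d hw
  by_contra! h
  obtain ⟨⟨q, hq, hq'⟩, ⟨r, hr, hr'⟩⟩ := h
  exact (hstar _ hq _ hr).elim hr' hq'

end
end
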